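/- arXiv:2511.00757 — 2 statements merged into one kernel-verified Lean document; each statement's English description precedes it below -/
import Mathlib

section
/- Let d ≥ 1, 1 ≤ m ≤ d, and let Q : ℤ^d → ℝ be (q₁, …, q_d)-periodic with q_{d−m+1} = ⋯ = q_d = 1, so that there is a (q₁, …, q_{d−m})-periodic function W : ℤ^{d−m} → ℝ with Q(u) = W(u₁, …, u_{d−m}) for all u ∈ ℤ^d. Then for every μ ∈ ℝ, the spectrum of H_{μQ} = Δ_{(1,d)} + μQ on ℓ²(ℤ^d) equals the Minkowski sum σ(Δ_{(1,d−m)} + μW) + [−2m, 2m], where Δ_{(1,d−m)} + μW acts on ℓ²(ℤ^{d−m}). -/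
open Pointwise

noncomputable abbrev L2 (X : Type) : Type := lp (fun _ : X => ℂ) 2

theorem L2_mem {X : Type} {f : X → ℂ} (h : Summable fun u => ‖f u‖ ^ 2) :
    Memℓp (E := fun _ : X => ℂ) f 2 := by
  apply memℓp_gen
  simpa using h

theorem L2_summable {X : Type} (f : L2 X) : Summable fun u => ‖f u‖ ^ 2 := by
  have := (lp.memℓp f).summable (by simp)
  simpa using this

theorem L2_norm_sq {X : Type} (f : L2 X) : ‖f‖ ^ 2 = ∑' u, ‖f u‖ ^ 2 := by
  have := lp.norm_rpow_eq_tsum (p := 2) (by simp) f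
  simpa using this

/-- Translation on `ℓ²`. -/
noncomputable def L2shift {X : Type} [AddCommGroup X] (w : X) (f : L2 X) : L2 X :=
  ⟨fun u => f (u + w), L2_mem (f := fun u => f (u + w)) (by
    have := (Equiv.addRight w).summable_iff.mpr (L2_summable f)
    exact this)⟩

theorem L2shift_apply {X : Type} [AddCommGroup X] (w : X) (f : L2 X) (u : X) :
    L2shift w f u = f (u + w) := rfl

theorem L2shift_norm {X : Type} [AddCommGroup X] (w : X) (f : L2 X) :
    ‖L2shift w f‖ = ‖f‖ := by
  rw [← sq_eq_sq₀ (norm_nonneg _) (norm_nonneg _), L2_norm_sq, L2_norm_sq]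
  exact (Equiv.addRight w).tsum_eq (fun u => ‖f u‖ ^ 2)

theorem L2shift_inner {X : Type} [AddCommGroup X] (w : X) (f g : L2 X) :
    inner ℂ (L2shift w f) g = inner ℂ f (L2shift (-w) g) := by
  rw [lp.inner_eq_tsum, lp.inner_eq_tsum,
    ← (Equiv.addRight w).tsum_eq (fun i => inner ℂ (f i) (L2shift (-w) g i))]
  simp [L2shift_apply]

/-- Schrödinger-type operators with real potential are self-adjoint. -/
theorem schr_selfAdjoint {X : Type} [AddCommGroup X] {J : Type} [Fintype J] (e : J → X) (V : X → ℝ)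
    (H : L2 X →L[ℂ] L2 X)
    (hH : ∀ (ψ : L2 X) (u : X), H ψ u = (V u : ℂ) * ψ u + ∑ j, (ψ (u - e j) + ψ (u + e j))) :
    IsSelfAdjoint H := by
  rw [ContinuousLinearMap.isSelfAdjoint_iff_isSymmetric]
  intro f g
  let S : L2 X → L2 X := fun f => ∑ j, (L2shift (-e j) f + L2shift (e j) f)
  have hS : ∀ f u, (S f) u = ∑ j, (f (u - e j) + f (u + e j)) := by
    intro f u
    simp only [S, lp.coeFn_sum, Finset.sum_apply, lp.coeFn_add, Pi.add_apply, L2shift_apply,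
      sub_eq_add_neg]
  have hM : ∀ f u, (H f - S f) u = (V u : ℂ) * f u := by
    intro f u
    rw [lp.coeFn_sub, Pi.sub_apply, hS, hH]; ring
  have h1 : inner ℂ (H f - S f) g = inner ℂ f (H g - S g) := by
    rw [lp.inner_eq_tsum, lp.inner_eq_tsum]
    congr 1; ext u
    rw [hM, hM]
    simp; ring
  have h2 : inner ℂ (S f) g = inner ℂ f (S g) := by
    simp only [S, sum_inner, inner_sum, inner_add_left, inner_add_right, L2shift_inner, neg_neg]
    exact Finset.sum_congr rfl fun j _ => add_comm _ _
  rw [inner_sub_left, inner_sub_right, h2] at h1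
  exact sub_left_injective h1

theorem isUnit_of_below {E : Type*} [NormedAddCommGroup E] [InnerProductSpace ℂ E] [CompleteSpace E]
    (T : E →L[ℂ] E) (hT : IsSelfAdjoint T) (c : ℝ) (hc : 0 < c) (h : ∀ f, c * ‖f‖ ≤ ‖T f‖) :
    IsUnit T := by
  rw [ContinuousLinearMap.isUnit_iff_bijective,
    ContinuousLinearMap.bijective_iff_dense_range_and_antilipschitz]
  have hinj : T.ker = ⊥ := by
    rw [LinearMap.ker_eq_bot']
    intro f hf
    have := h f
    have hf' : T f = 0 := hf
    rw [hf', norm_zero] at this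
    have : ‖f‖ ≤ 0 := by nlinarith [norm_nonneg f]
    simpa using this
  constructor
  · rw [Submodule.topologicalClosure_eq_top_iff, ContinuousLinearMap.orthogonal_range,
      hT.adjoint_eq, hinj]
  · refine ⟨⟨c⁻¹, by positivity⟩, ?_⟩
    refine ContinuousLinearMap.antilipschitz_of_bound T fun f => ?_
    show ‖f‖ ≤ c⁻¹ * _
    rw [le_inv_mul_iff₀ hc]
    exact h f

theorem below_of_isUnit {E : Type*} [NormedAddCommGroup E] [NormedSpace ℂ E]
    (T : E →L[ℂ] E) (hT : IsUnit T) : ∃ c : ℝ, 0 < c ∧ ∀ f, c * ‖f‖ ≤ ‖T f‖ := by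
  obtain ⟨u, rfl⟩ := hT
  refine ⟨(‖(↑u⁻¹ : E →L[ℂ] E)‖ + 1)⁻¹, by positivity, fun f => ?_⟩
  rw [inv_mul_le_iff₀ (by positivity)]
  have h : (↑u⁻¹ : E →L[ℂ] E) ((u : E →L[ℂ] E) f) = f := by
    rw [← mul_apply_eq_comp, Units.inv_mul]; rfl
  calc ‖f‖ = ‖(↑u⁻¹ : E →L[ℂ] E) ((u : E →L[ℂ] E) f)‖ := by rw [h]
    _ ≤ ‖(↑u⁻¹ : E →L[ℂ] E)‖ * ‖(u : E →L[ℂ] E) f‖ := ContinuousLinearMap.le_opNorm _ _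
    _ ≤ _ := by gcongr; simp

/-- quantitative lower bound -/
theorem below_of_dist {E : Type*} [NormedAddCommGroup E] [InnerProductSpace ℂ E] [CompleteSpace E]
    [Nontrivial E]
    (T : E →L[ℂ] E) (hT : IsSelfAdjoint T) (r : ℝ) (hr : 0 < r)
    (h : ∀ x : ℝ, (x : ℂ) ∈ spectrum ℂ T → r < |x|) :
    ∃ c : ℝ, r < c ∧ ∀ f, c * ‖f‖ ≤ ‖T f‖ := by
  have hu : IsUnit T := by
    by_contra hn
    have := h 0 (by simpa [spectrum.zero_mem_iff] using hn)
    simp at this; linarith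
  obtain ⟨u, rfl⟩ := hu
  have hsa : IsSelfAdjoint (↑u⁻¹ : E →L[ℂ] E) := by
    have h1 : star u = u := Units.ext hT
    rw [isSelfAdjoint_iff, ← Units.coe_star, star_inv, h1]
  obtain ⟨k, hk, hk2⟩ := spectrum.exists_nnnorm_eq_spectralRadius (↑u⁻¹ : E →L[ℂ] E)
  rw [IsSelfAdjoint.spectralRadius_eq_nnnorm hsa] at hk2
  have hk3 : ‖k‖ = ‖(↑u⁻¹ : E →L[ℂ] E)‖ := by
    have : ‖k‖₊ = ‖(↑u⁻¹ : E →L[ℂ] E)‖₊ := by exact_mod_cast hk2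
    exact congrArg NNReal.toReal this
  have hk0 : k ≠ 0 := spectrum.ne_zero_of_mem_of_unit hk
  have hkr : k = (k.re : ℂ) := hsa.mem_spectrum_eq_re hk
  have hmem : ((k.re⁻¹ : ℝ) : ℂ) ∈ spectrum ℂ (u : E →L[ℂ] E) := by
    have := (spectrum.inv_mem_iff (r := Units.mk0 k hk0) (a := u⁻¹)).mp hk
    rw [inv_inv] at this
    rw [Complex.ofReal_inv, ← hkr]
    simpa using this
  have h3 := h _ hmem
  have h4 : |k.re⁻¹| = ‖k‖⁻¹ := by
    conv_rhs => rw [hkr]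
    rw [Complex.norm_real, Real.norm_eq_abs, abs_inv]
  rw [h4] at h3
  refine ⟨_, h3, fun f => ?_⟩
  rw [inv_mul_le_iff₀ (by positivity), hk3]
  have h : (↑u⁻¹ : E →L[ℂ] E) ((u : E →L[ℂ] E) f) = f := by
    rw [← mul_apply_eq_comp, Units.inv_mul]; rfl
  calc ‖f‖ = ‖(↑u⁻¹ : E →L[ℂ] E) ((u : E →L[ℂ] E) f)‖ := by rw [h]
    _ ≤ ‖(↑u⁻¹ : E →L[ℂ] E)‖ * ‖(u : E →L[ℂ] E) f‖ := ContinuousLinearMap.le_opNorm _ _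

section slices
variable {X Y Z : Type} [AddCommGroup X] [AddCommGroup Y] [AddCommGroup Z] (E : X × Y ≃+ Z)

theorem L2_summable_pair (f : L2 Z) : Summable fun p : Y × X => ‖f (E (p.2, p.1))‖ ^ 2 :=
  ((Equiv.prodComm Y X).trans E.toEquiv).summable_iff.mpr (L2_summable f)

/-- Slice of a square-summable function. -/
noncomputable def L2slice (y : Y) (f : L2 Z) : L2 X :=
  ⟨fun x => f (E (x, y)), L2_mem (f := fun x => f (E (x, y)))
    ((L2_summable_pair E f).prod_factor y)⟩

theorem L2slice_apply (y : Y) (f : L2 Z) (x : X) : L2slice E y f x = f (E (x, y)) := rfl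

theorem L2slice_summable (f : L2 Z) : Summable fun y => ‖L2slice E y f‖ ^ 2 := by
  simp only [L2_norm_sq, L2slice_apply]
  exact (L2_summable_pair E f).prod

theorem L2slice_norm (f : L2 Z) : ‖f‖ ^ 2 = ∑' y, ‖L2slice E y f‖ ^ 2 := by
  simp only [L2_norm_sq, L2slice_apply]
  rw [← (L2_summable_pair E f).tsum_prod]
  exact (((Equiv.prodComm Y X).trans E.toEquiv).tsum_eq (fun z => ‖f z‖ ^ 2)).symm

theorem L2tensor_summable (ψ : L2 X) (φ : L2 Y) :
    Summable fun p : X × Y => ‖ψ p.1‖ ^ 2 * ‖φ p.2‖ ^ 2 :=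
  (L2_summable ψ).mul_of_nonneg (L2_summable φ) (fun _ => by positivity) (fun _ => by positivity)

/-- Tensor product of square-summable functions. -/
noncomputable def L2tensor (ψ : L2 X) (φ : L2 Y) : L2 Z :=
  ⟨fun z => ψ (E.symm z).1 * φ (E.symm z).2,
    L2_mem (f := fun z => ψ (E.symm z).1 * φ (E.symm z).2) (by
      simp only [norm_mul, mul_pow]
      have := E.symm.toEquiv.summable_iff.mpr (L2tensor_summable ψ φ)
      exact this)⟩

theorem L2tensor_apply (ψ : L2 X) (φ : L2 Y) (x : X) (y : Y) :
    L2tensor E ψ φ (E (x, y)) = ψ x * φ y := by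
  show ψ (E.symm _).1 * φ (E.symm _).2 = _
  simp

theorem L2tensor_norm (ψ : L2 X) (φ : L2 Y) : ‖L2tensor E ψ φ‖ = ‖ψ‖ * ‖φ‖ := by
  rw [← sq_eq_sq₀ (norm_nonneg _) (by positivity), mul_pow, L2_norm_sq ψ, L2_norm_sq φ, L2_norm_sq,
    (L2_summable ψ).tsum_mul_tsum (L2_summable φ) (L2tensor_summable ψ φ),
    ← E.toEquiv.tsum_eq]
  congr 1; ext ⟨x, y⟩
  show ‖L2tensor E ψ φ (E (x, y))‖ ^ 2 = _
  rw [L2tensor_apply, norm_mul, mul_pow]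

variable {J K : Type} [Fintype J] [Fintype K] (e : J → X) (k : K → Y) (V : X → ℝ)
  (H : L2 Z →L[ℂ] L2 Z) (H' : L2 X →L[ℂ] L2 X)

theorem below_sum
    (hH : ∀ (ψ : L2 Z) (x : X) (y : Y), H ψ (E (x, y)) = (V x : ℂ) * ψ (E (x, y))
      + ∑ j, (ψ (E (x - e j, y)) + ψ (E (x + e j, y)))
      + ∑ j, (ψ (E (x, y - k j)) + ψ (E (x, y + k j))))
    (hH' : ∀ (ψ : L2 X) (u : X), H' ψ u = (V u : ℂ) * ψ u + ∑ j, (ψ (u - e j) + ψ (u + e j)))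
    (z : ℂ) (c : ℝ) (hc : 0 ≤ c) (hb : ∀ f, c * ‖f‖ ≤ ‖(H' - algebraMap ℂ _ z) f‖) (f : L2 Z) :
    (c - 2 * Fintype.card K) * ‖f‖ ≤ ‖(H - algebraMap ℂ _ z) f‖ := by
  set B : L2 Z := ∑ j, (L2shift (-E (0, k j)) f + L2shift (E (0, k j)) f) with hB
  have hBv : ∀ x y, B (E (x, y)) = ∑ j, (f (E (x, y - k j)) + f (E (x, y + k j))) := by
    intro x y
    simp only [hB, lp.coeFn_sum, Finset.sum_apply, lp.coeFn_add, Pi.add_apply, L2shift_apply,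
      ← map_neg, ← map_add, Prod.mk_add_mk, Prod.neg_mk, neg_zero, add_zero, sub_eq_add_neg]
  have hBn : ‖B‖ ≤ 2 * Fintype.card K * ‖f‖ := by
    refine (norm_sum_le _ _).trans ?_
    calc _ ≤ ∑ j : K, 2 * ‖f‖ := by
          refine Finset.sum_le_sum fun j _ => (norm_add_le _ _).trans ?_
          rw [L2shift_norm, L2shift_norm]; linarith
      _ = _ := by simp; ring
  set A : L2 Z := (H - algebraMap ℂ _ z) f - B with hA
  have hsl : ∀ y, L2slice E y A = (H' - algebraMap ℂ _ z) (L2slice E y f) := by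
    intro y
    apply lp.ext; funext x
    rw [L2slice_apply]
    simp only [hA, Algebra.algebraMap_eq_smul_one, sub_apply,
      smul_apply, one_apply_eq_self, lp.coeFn_sub, Pi.sub_apply,
      lp.coeFn_smul, Pi.smul_apply, hH, hH', hBv, L2slice_apply]
    ring
  have hAn : c * ‖f‖ ≤ ‖A‖ := by
    rw [← sq_le_sq₀ (by positivity) (norm_nonneg _), mul_pow, L2slice_norm E f, L2slice_norm E A,
      ← tsum_mul_left]
    refine Summable.tsum_le_tsum (fun y => ?_) ((L2slice_summable E f).mul_left _)
      (L2slice_summable E A)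
    rw [hsl, ← mul_pow]
    have := hb (L2slice E y f)
    gcongr
  have := norm_sub_le ((H - algebraMap ℂ _ z) f) B
  rw [← hA] at this
  linarith

theorem approx_sum
    (hH : ∀ (ψ : L2 Z) (x : X) (y : Y), H ψ (E (x, y)) = (V x : ℂ) * ψ (E (x, y))
      + ∑ j, (ψ (E (x - e j, y)) + ψ (E (x + e j, y)))
      + ∑ j, (ψ (E (x, y - k j)) + ψ (E (x, y + k j))))
    (hH' : ∀ (ψ : L2 X) (u : X), H' ψ u = (V u : ℂ) * ψ u + ∑ j, (ψ (u - e j) + ψ (u + e j)))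
    (z w : ℂ) (ε η : ℝ) (hη : 0 ≤ η) (ψ : L2 X) (φ : L2 Y)
    (hψ : ‖(H' - algebraMap ℂ _ z) ψ‖ ≤ ε * ‖ψ‖)
    (hφ : ∀ y, ‖∑ j, (φ (y - k j) + φ (y + k j)) - w * φ y‖ ≤ η * ‖φ y‖) :
    ‖(H - algebraMap ℂ _ (z + w)) (L2tensor E ψ φ)‖ ≤ (ε + η) * ‖L2tensor E ψ φ‖ := by
  set G : L2 Z := (H - algebraMap ℂ _ (z + w)) (L2tensor E ψ φ) -
    L2tensor E ((H' - algebraMap ℂ _ z) ψ) φ with hG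
  have hGv : ∀ x y, G (E (x, y)) = ψ x * (∑ j, (φ (y - k j) + φ (y + k j)) - w * φ y) := by
    intro x y
    simp only [hG, Algebra.algebraMap_eq_smul_one, sub_apply,
      smul_apply, one_apply_eq_self, lp.coeFn_sub, Pi.sub_apply,
      lp.coeFn_smul, Pi.smul_apply, hH, hH', L2tensor_apply, smul_eq_mul, ← mul_add, ← add_mul,
      ← Finset.mul_sum, ← Finset.sum_mul]
    ring
  have hGn : ‖G‖ ≤ η * ‖L2tensor E ψ φ‖ := by
    have h1 : ‖G‖ ≤ ‖(η : ℂ) • L2tensor E ψ φ‖ := by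
      refine lp.norm_mono (by simp) fun z => ?_
      obtain ⟨⟨x, y⟩, rfl⟩ := E.surjective z
      rw [hGv, lp.coeFn_smul, Pi.smul_apply, L2tensor_apply, norm_smul, norm_mul, norm_mul,
        Complex.norm_real, Real.norm_of_nonneg hη]
      have := mul_le_mul_of_nonneg_left (hφ y) (norm_nonneg (ψ x))
      linarith
    rwa [norm_smul, Complex.norm_real, Real.norm_of_nonneg hη] at h1
  have h2 : ‖L2tensor E ((H' - algebraMap ℂ _ z) ψ) φ‖ ≤ ε * ‖L2tensor E ψ φ‖ := by
    rw [L2tensor_norm, L2tensor_norm, ← mul_assoc]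
    gcongr
  have h3 : (H - algebraMap ℂ _ (z + w)) (L2tensor E ψ φ) =
    G + L2tensor E ((H' - algebraMap ℂ _ z) ψ) φ := by rw [hG]; abel
  rw [h3]
  refine (norm_add_le _ _).trans ?_
  linarith

end slices

theorem weight_step (δ : ℝ) (hδ : 0 < δ) (a b : ℤ) (hab : a = b + 1 ∨ a = b - 1) :
    |((1 + δ)⁻¹) ^ a.natAbs - ((1 + δ)⁻¹) ^ b.natAbs| ≤ δ * ((1 + δ)⁻¹) ^ b.natAbs := by
  have h : a.natAbs = b.natAbs + 1 ∨ b.natAbs = a.natAbs + 1 := by omega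
  have hp : ∀ n : ℕ, 0 < ((1 + δ)⁻¹) ^ n := fun n => by positivity
  have hs : (1 + δ)⁻¹ * (1 + δ) = 1 := inv_mul_cancel₀ (by positivity)
  have hs0 : 0 < (1 + δ)⁻¹ := by positivity
  have hs1 : (1 + δ)⁻¹ ≤ 1 := inv_le_one_of_one_le₀ (by linarith)
  have hs2 : 1 - (1 + δ)⁻¹ ≤ δ := by nlinarith
  rcases h with h | h
  · rw [h, pow_succ, abs_le]
    have := hp b.natAbs
    constructor <;> nlinarith
  · rw [h, pow_succ, abs_le]
    have := hp a.natAbs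
    have h3 : δ * (((1 + δ)⁻¹) ^ a.natAbs * (1 + δ)⁻¹) =
      ((1 + δ)⁻¹) ^ a.natAbs - ((1 + δ)⁻¹) ^ a.natAbs * (1 + δ)⁻¹ := by
      linear_combination ((1 + δ)⁻¹) ^ a.natAbs * hs
    rw [h3]
    constructor <;> nlinarith

theorem summable_pi_prod {m : ℕ} (g : ℤ → ℝ) (hg : ∀ n, 0 ≤ g n) (hs : Summable g) :
    Summable fun v : Fin m → ℤ => ∏ j, g (v j) := by
  refine summable_of_sum_le (c := ∏ _j : Fin m, ∑' n, g n)
    (fun v => Finset.prod_nonneg fun j _ => hg _) fun s => ?_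
  classical
  calc _ ≤ ∑ v ∈ Fintype.piFinset (fun j => s.image fun v => v j), ∏ j, g (v j) := by
        refine Finset.sum_le_sum_of_subset_of_nonneg (fun v hv => ?_)
          fun v _ _ => Finset.prod_nonneg fun j _ => hg _
        rw [Fintype.mem_piFinset]
        exact fun j => Finset.mem_image_of_mem _ hv
    _ = ∏ j, ∑ n ∈ s.image (fun v => v j), g n := (Finset.prod_univ_sum _ _).symm
    _ ≤ _ := Finset.prod_le_prod (fun j _ => Finset.sum_nonneg fun n _ => hg n)
        fun j _ => hs.sum_le_tsum _ fun n _ => hg n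

theorem summable_weight (r : ℝ) (h0 : 0 ≤ r) (h1 : r < 1) : Summable fun n : ℤ => r ^ n.natAbs := by
  apply Summable.of_nat_of_neg
  · simpa using summable_geometric_of_lt_one h0 h1
  · simpa using summable_geometric_of_lt_one h0 h1

theorem norm_step (a b c p : ℂ) (δ : ℝ) (h : ‖a - p * b‖ ≤ δ * ‖b‖) :
    ‖a * c - p * (b * c)‖ ≤ δ * ‖b * c‖ := by
  have e : a * c - p * (b * c) = (a - p * b) * c := by ring
  rw [e, norm_mul, norm_mul, ← mul_assoc]
  exact mul_le_mul_of_nonneg_right h (norm_nonneg c)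

theorem exists_wave {m : ℕ} (hm : 1 ≤ m) (y : ℝ) (hy : |y| ≤ 2 * m) (η : ℝ) (hη : 0 < η) :
    ∃ φ : L2 (Fin m → ℤ), φ ≠ 0 ∧ ∀ v, ‖∑ j, (φ (v - Pi.single j 1) + φ (v + Pi.single j 1))
      - (y : ℂ) * φ v‖ ≤ η * ‖φ v‖ := by
  have hm0 : (0 : ℝ) < m := by exact_mod_cast hm
  obtain ⟨θ, hθ⟩ : ∃ θ : ℝ, Real.cos θ = y / (2 * m) := by
    refine ⟨Real.arccos (y / (2 * m)), Real.cos_arccos ?_ ?_⟩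
    · rw [le_div_iff₀ (by positivity)]; linarith [(abs_le.mp hy).1]
    · rw [div_le_iff₀ (by positivity)]; linarith [(abs_le.mp hy).2]
  set δ : ℝ := η / (2 * m) with hδ
  have hδ0 : 0 < δ := by positivity
  set p : ℂ := Complex.exp (θ * Complex.I) with hp
  have hpn : ‖p‖ = 1 := Complex.norm_exp_ofReal_mul_I θ
  have hp0 : p ≠ 0 := Complex.exp_ne_zero _
  set w : ℤ → ℝ := fun n => ((1 + δ)⁻¹) ^ n.natAbs with hw
  have hw0 : ∀ n, 0 < w n := fun n => by simp only [hw]; positivity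
  set g : ℤ → ℂ := fun n => (w n : ℂ) * p ^ n with hg
  have hgn : ∀ n, ‖g n‖ = w n := by
    intro n
    simp only [hg, norm_mul, norm_zpow, hpn, one_zpow, mul_one, Complex.norm_real]
    exact Real.norm_of_nonneg (hw0 n).le
  have hgp : ∀ n, ‖g (n + 1) - p * g n‖ ≤ δ * ‖g n‖ := by
    intro n
    have : g (n + 1) - p * g n = ((w (n + 1) - w n : ℝ) : ℂ) * p ^ (n + 1) := by
      simp only [hg, zpow_add_one₀ hp0]; push_cast; ring
    rw [this, norm_mul, norm_zpow, hpn, one_zpow, mul_one, Complex.norm_real, hgn]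
    exact weight_step δ hδ0 _ _ (Or.inl rfl)
  have hgm : ∀ n, ‖g (n - 1) - p⁻¹ * g n‖ ≤ δ * ‖g n‖ := by
    intro n
    have : g (n - 1) - p⁻¹ * g n = ((w (n - 1) - w n : ℝ) : ℂ) * p ^ (n - 1) := by
      simp only [hg, zpow_sub_one₀ hp0]; push_cast; ring
    rw [this, norm_mul, norm_zpow, hpn, one_zpow, mul_one, Complex.norm_real, hgn]
    exact weight_step δ hδ0 _ _ (Or.inr rfl)
  have hpp : p + p⁻¹ = ((y / m : ℝ) : ℂ) := by
    rw [hp, ← Complex.exp_neg, ← neg_mul, ← Complex.two_cos, ← Complex.ofReal_cos, hθ]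
    push_cast
    field_simp
  have hmem : Memℓp (E := fun _ : Fin m → ℤ => ℂ) (fun v => ∏ j, g (v j)) 2 := by
    apply L2_mem
    simp only [norm_prod, hgn, ← Finset.prod_pow]
    refine summable_pi_prod (fun n => w n ^ 2) (fun n => by positivity) ?_
    simp only [hw, ← pow_mul, mul_comm _ 2]
    simp only [pow_mul]
    refine summable_weight _ (by positivity) ?_
    refine pow_lt_one₀ (by positivity) (inv_lt_one_of_one_lt₀ (by linarith)) (by norm_num)
  set φ : L2 (Fin m → ℤ) := ⟨fun v => ∏ j, g (v j), hmem⟩ with hφ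
  have hφv : ∀ v, φ v = ∏ j, g (v j) := fun v => rfl
  have hne : ∀ v, φ v ≠ 0 := by
    intro v
    rw [hφv, Finset.prod_ne_zero_iff]
    intro j _ h0
    have := hgn (v j)
    rw [h0, norm_zero] at this
    exact (hw0 (v j)).ne this
  have hsplit : ∀ (v : Fin m → ℤ) (j : Fin m), φ v = g (v j) * ∏ i ∈ Finset.univ.erase j, g (v i) :=
    fun v j => (Finset.mul_prod_erase _ (fun i => g (v i)) (Finset.mem_univ j)).symm
  have hsp : ∀ (v : Fin m → ℤ) (j : Fin m) , φ (v + Pi.single j 1) =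
      g (v j + 1) * ∏ i ∈ Finset.univ.erase j, g (v i) := by
    intro v j
    rw [hsplit _ j]
    congr 1
    · simp
    · refine Finset.prod_congr rfl fun i hi => ?_
      simp [Finset.ne_of_mem_erase hi]
  have hsm : ∀ (v : Fin m → ℤ) (j : Fin m) , φ (v - Pi.single j 1) =
      g (v j - 1) * ∏ i ∈ Finset.univ.erase j, g (v i) := by
    intro v j
    rw [hsplit _ j]
    congr 1
    · simp
    · refine Finset.prod_congr rfl fun i hi => ?_
      simp [Finset.ne_of_mem_erase hi]
  refine ⟨φ, fun h => hne 0 (by rw [h]; rfl), fun v => ?_⟩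
  have e1 : ∑ j, (φ (v - Pi.single j 1) + φ (v + Pi.single j 1)) - (y : ℂ) * φ v =
      ∑ j : Fin m, ((φ (v - Pi.single j 1) - p⁻¹ * φ v) + (φ (v + Pi.single j 1) - p * φ v)) := by
    have : (y : ℂ) * φ v = ∑ j : Fin m, (p + p⁻¹) * φ v := by
      have hm1 : (m : ℂ) ≠ 0 := by exact_mod_cast hm0.ne'
      rw [hpp]; simp; field_simp
    rw [this, ← Finset.sum_sub_distrib]
    exact Finset.sum_congr rfl fun j _ => by ring
  rw [e1]
  refine (norm_sum_le _ _).trans ?_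
  calc _ ≤ ∑ j : Fin m, 2 * δ * ‖φ v‖ := by
        refine Finset.sum_le_sum fun j _ => (norm_add_le _ _).trans ?_
        have a1 : ‖φ (v - Pi.single j 1) - p⁻¹ * φ v‖ ≤ δ * ‖φ v‖ := by
          rw [hsm, hsplit v j]
          exact norm_step _ _ _ _ _ (hgm (v j))
        have a2 : ‖φ (v + Pi.single j 1) - p * φ v‖ ≤ δ * ‖φ v‖ := by
          rw [hsp, hsplit v j]
          exact norm_step _ _ _ _ _ (hgp (v j))
        linarith
    _ = η * ‖φ v‖ := by
        simp [hδ]; field_simp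

theorem spec_iff {E : Type*} [NormedAddCommGroup E] [NormedSpace ℂ E] (T : E →L[ℂ] E) (z : ℂ) :
    z ∈ spectrum ℂ T ↔ ¬ IsUnit (T - algebraMap ℂ _ z) := by
  rw [spectrum.mem_iff, ← IsUnit.neg_iff, neg_sub]

theorem sub_selfAdjoint {E : Type*} [NormedAddCommGroup E] [InnerProductSpace ℂ E] [CompleteSpace E]
    (T : E →L[ℂ] E) (hT : IsSelfAdjoint T) (x : ℝ) :
    IsSelfAdjoint (T - algebraMap ℂ (E →L[ℂ] E) (x : ℂ)) := by
  refine hT.sub (IsSelfAdjoint.algebraMap _ ?_)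
  simp [isSelfAdjoint_iff]

theorem spectrum_core {X Z : Type} [AddCommGroup X] [AddCommGroup Z] {m : ℕ} (hm : 1 ≤ m)
    (E : X × (Fin m → ℤ) ≃+ Z) {J : Type} [Fintype J] (e : J → X) (V : X → ℝ)
    (H : L2 Z →L[ℂ] L2 Z) (H' : L2 X →L[ℂ] L2 X) (hHsa : IsSelfAdjoint H)
    (hH : ∀ (ψ : L2 Z) (x : X) (y : Fin m → ℤ), H ψ (E (x, y)) = (V x : ℂ) * ψ (E (x, y))
      + ∑ j, (ψ (E (x - e j, y)) + ψ (E (x + e j, y)))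
      + ∑ j, (ψ (E (x, y - Pi.single j 1)) + ψ (E (x, y + Pi.single j 1))))
    (hH' : ∀ (ψ : L2 X) (u : X), H' ψ u = (V u : ℂ) * ψ u + ∑ j, (ψ (u - e j) + ψ (u + e j))) :
    {x : ℝ | (x : ℂ) ∈ spectrum ℂ H} =
      {x : ℝ | (x : ℂ) ∈ spectrum ℂ H'} + Set.Icc (-(2 * (m : ℝ))) (2 * (m : ℝ)) := by
  have hH'sa := schr_selfAdjoint e V H' hH'
  have hm0 : (0 : ℝ) < m := by exact_mod_cast hm
  ext z
  rw [Set.mem_add]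
  constructor
  · intro hz
    by_contra hcon
    push Not at hcon
    haveI : Nontrivial (L2 X) := by
      classical
      refine ⟨⟨lp.single 2 0 1, 0, fun h => ?_⟩⟩
      have := congrArg (fun f : L2 X => f 0) h
      simp at this
    obtain ⟨c, hc, hb⟩ := below_of_dist (H' - algebraMap ℂ _ (z : ℂ)) (sub_selfAdjoint _ hH'sa z)
      (2 * m) (by positivity) (by
        intro x hx
        by_contra hle
        push Not at hle
        have hx' : ((x + z : ℝ) : ℂ) ∈ spectrum ℂ H' := by
          rw [spec_iff] at hx ⊢
          have : H' - algebraMap ℂ (L2 X →L[ℂ] L2 X) ((x + z : ℝ) : ℂ) =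
            H' - algebraMap ℂ _ (z : ℂ) - algebraMap ℂ _ (x : ℂ) := by
            rw [Complex.ofReal_add, map_add]; abel
          rwa [this]
        rw [abs_le] at hle
        exact hcon (x + z) hx' (-x) ⟨by linarith, by linarith⟩ (by ring))
    have hb2 := below_sum E e (fun j : Fin m => Pi.single j 1) V H H' hH hH' z c (by linarith) hb
    rw [Fintype.card_fin] at hb2
    have hz' : (z : ℂ) ∈ spectrum ℂ H := hz
    rw [spec_iff] at hz'
    exact hz' (isUnit_of_below _ (sub_selfAdjoint _ hHsa z) _ (by linarith) hb2)
  · rintro ⟨x, hx, y, hy, rfl⟩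
    show ((x + y : ℝ) : ℂ) ∈ spectrum ℂ H
    have hx' : (x : ℂ) ∈ spectrum ℂ H' := hx
    rw [spec_iff] at hx' ⊢
    intro hu
    obtain ⟨c, hc, hb⟩ := below_of_isUnit _ hu
    have : ∃ ψ : L2 X, ‖(H' - algebraMap ℂ _ (x : ℂ)) ψ‖ < c / 3 * ‖ψ‖ := by
      by_contra hcon
      push Not at hcon
      exact hx' (isUnit_of_below _ (sub_selfAdjoint _ hH'sa x) _ (by positivity) hcon)
    obtain ⟨ψ, hψ⟩ := this
    obtain ⟨φ, hφ0, hφ⟩ := exists_wave hm y (abs_le.mpr hy) (c / 3) (by positivity)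
    have h1 := approx_sum E e (fun j : Fin m => Pi.single j 1) V H H' hH hH' x y (c / 3) (c / 3)
      (by positivity) ψ φ hψ.le hφ
    have h2 := hb (L2tensor E ψ φ)
    rw [Complex.ofReal_add] at h2
    have h3 : 0 < ‖ψ‖ := by
      by_contra h
      have : ‖ψ‖ = 0 := le_antisymm (not_lt.mp h) (norm_nonneg _)
      rw [this, mul_zero] at hψ
      exact absurd hψ (not_lt.mpr (norm_nonneg _))
    have h4 : 0 < ‖L2tensor E ψ φ‖ := by
      rw [L2tensor_norm]
      exact mul_pos h3 (norm_pos_iff.mpr hφ0)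
    nlinarith

/-- Additive splitting of `ℤ^(n+m)`. -/
def appendAdd (n m : ℕ) : (Fin n → ℤ) × (Fin m → ℤ) ≃+ (Fin (n + m) → ℤ) where
  toEquiv := Fin.appendEquiv n m
  map_add' := by
    rintro ⟨a, b⟩ ⟨a', b'⟩
    funext i
    refine Fin.addCases (fun i => ?_) (fun i => ?_) i <;> simp [Fin.appendEquiv]

theorem appendAdd_apply (n m : ℕ) (x : Fin n → ℤ) (y : Fin m → ℤ) :
    appendAdd n m (x, y) = Fin.append x y := rfl

theorem single_castAdd (n m : ℕ) (i : Fin n) :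
    (Pi.single (Fin.castAdd m i) 1 : Fin (n + m) → ℤ) = appendAdd n m (Pi.single i 1, 0) := by
  funext j
  rw [appendAdd_apply]
  refine Fin.addCases (fun j => ?_) (fun j => ?_) j
  · simp [Pi.single_apply]
  · have : Fin.natAdd n j ≠ Fin.castAdd m i := by
      intro h; have := congrArg Fin.val h; simp at this; omega
    simp [Pi.single_apply, this]

theorem single_natAdd (n m : ℕ) (i : Fin m) :
    (Pi.single (Fin.natAdd n i) 1 : Fin (n + m) → ℤ) = appendAdd n m (0, Pi.single i 1) := by
  funext j
  rw [appendAdd_apply]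
  refine Fin.addCases (fun j => ?_) (fun j => ?_) j
  · have : Fin.castAdd m j ≠ Fin.natAdd n i := by
      intro h; have := congrArg Fin.val h; simp at this; omega
    simp [Pi.single_apply, this]
  · simp [Pi.single_apply]

theorem spectrum_aux {d m n : ℕ} (hm : 1 ≤ m) (hd : d = n + m) (hn : n ≤ d)
    (Q : (Fin d → ℤ) → ℝ) (W : (Fin n → ℤ) → ℝ)
    (hQW : ∀ u : Fin d → ℤ, Q u = W (fun i => u (Fin.castLE hn i)))
    (μ : ℝ) (H : L2 (Fin d → ℤ) →L[ℂ] L2 (Fin d → ℤ))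
    (hH : ∀ (ψ : L2 (Fin d → ℤ)) (u : Fin d → ℤ),
      H ψ u = ((μ * Q u : ℝ) : ℂ) * ψ u +
        ∑ j : Fin d, (ψ (u - Pi.single j 1) + ψ (u + Pi.single j 1)))
    (H' : L2 (Fin n → ℤ) →L[ℂ] L2 (Fin n → ℤ))
    (hH' : ∀ (ψ : L2 (Fin n → ℤ)) (u : Fin n → ℤ),
      H' ψ u = ((μ * W u : ℝ) : ℂ) * ψ u +
        ∑ j : Fin n, (ψ (u - Pi.single j 1) + ψ (u + Pi.single j 1))) :
    {x : ℝ | (x : ℂ) ∈ spectrum ℂ H} =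
      {x : ℝ | (x : ℂ) ∈ spectrum ℂ H'} + Set.Icc (-(2 * (m : ℝ))) (2 * (m : ℝ)) := by
  subst hd
  refine spectrum_core hm (appendAdd n m) (fun j => Pi.single j 1) (fun u => μ * W u) H H'
    (schr_selfAdjoint (fun j => Pi.single j 1) (fun u => μ * Q u) H hH) ?_ hH'
  intro ψ x y
  have hQ : Q (appendAdd n m (x, y)) = W x := by
    rw [hQW]
    congr 1
    funext i
    exact Fin.append_left x y i
  rw [hH, hQ, Fin.sum_univ_add, add_assoc]
  simp only [single_castAdd, single_natAdd, ← map_add, ← map_sub, Prod.mk_add_mk, Prod.mk_sub_mk,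
    add_zero, sub_zero]


/-- Separability of the spectrum: if `Q : ℤ^d → ℝ` is `(q₁,…,q_d)`-periodic with
`q_{d−m+1} = ⋯ = q_d = 1`, so that `Q(u) = W(u₁,…,u_{d−m})` for a function `W` on
`ℤ^{d−m}`, then for every `μ ∈ ℝ` the spectrum of `H_{μQ} = Δ_{(1,d)} + μQ` on
`ℓ²(ℤ^d)` is the Minkowski sum of the spectrum of `Δ_{(1,d−m)} + μW` on `ℓ²(ℤ^{d−m})`
and the interval `[−2m, 2m]`. -/
theorem spectrum_separable_eq_minkowski_sum
    {d m : ℕ} (hd : 1 ≤ d) (hm : 1 ≤ m) (hmd : m ≤ d)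
    (q : Fin d → ℕ) (hqpos : ∀ j, 0 < q j)
    (Q : (Fin d → ℤ) → ℝ)
    -- `Q` is `(q₁,…,q_d)`-periodic
    (hQper : ∀ (j : Fin d) (u : Fin d → ℤ), Q (u + (q j : ℤ) • Pi.single j 1) = Q u)
    -- the last `m` periods equal `1`
    (hqlast : ∀ j : Fin d, d - m ≤ (j : ℕ) → q j = 1)
    -- `W` is the function on `ℤ^{d−m}` induced by `Q`
    (W : (Fin (d - m) → ℤ) → ℝ)
    (hQW : ∀ u : Fin d → ℤ, Q u = W (fun i => u (Fin.castLE (Nat.sub_le d m) i)))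
    (μ : ℝ)
    -- `H` is the operator `Δ_{(1,d)} + μQ` on `ℓ²(ℤ^d)`
    (H : lp (fun _ : (Fin d → ℤ) => ℂ) 2 →L[ℂ] lp (fun _ : (Fin d → ℤ) => ℂ) 2)
    (hH : ∀ (ψ : lp (fun _ : (Fin d → ℤ) => ℂ) 2) (u : Fin d → ℤ),
      H ψ u = ((μ * Q u : ℝ) : ℂ) * ψ u +
        ∑ j : Fin d, (ψ (u - Pi.single j 1) + ψ (u + Pi.single j 1)))
    -- `H'` is the operator `Δ_{(1,d−m)} + μW` on `ℓ²(ℤ^{d−m})`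
    (H' : lp (fun _ : (Fin (d - m) → ℤ) => ℂ) 2 →L[ℂ] lp (fun _ : (Fin (d - m) → ℤ) => ℂ) 2)
    (hH' : ∀ (ψ : lp (fun _ : (Fin (d - m) → ℤ) => ℂ) 2) (u : Fin (d - m) → ℤ),
      H' ψ u = ((μ * W u : ℝ) : ℂ) * ψ u +
        ∑ j : Fin (d - m), (ψ (u - Pi.single j 1) + ψ (u + Pi.single j 1))) :
    {x : ℝ | (x : ℂ) ∈ spectrum ℂ H} =
      {x : ℝ | (x : ℂ) ∈ spectrum ℂ H'} + Set.Icc (-(2 * (m : ℝ))) (2 * (m : ℝ)) := by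
  exact spectrum_aux hm (by omega) (Nat.sub_le d m) Q W hQW μ H hH H' hH'
end

section
/- Let d ≥ 1, 1 ≤ m ≤ d, and let Q : ℤ^d → ℝ be (q₁, …, q_d)-periodic with q_{d−m+1} = ⋯ = q_d = 1, and let r = #{Q(n) : n ∈ ℤ^d} denote the number of distinct values taken by Q. Then for all sufficiently large μ > 0, the Lebesgue measure of the spectrum of H_{μQ} = Δ_{(1,d)} + μQ on ℓ²(ℤ^d) is at least 4mr. -/
open MeasureTheory

theorem aux_character {𝔸 : Type*} [NormedRing 𝔸] [NormOneClass 𝔸] [NormedAlgebra ℂ 𝔸] [CompleteSpace 𝔸]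
    [Nontrivial 𝔸] {ι : Type*} (h : 𝔸) (T T' : ι → 𝔸) (hTT' : ∀ j, T j * T' j = 1)
    (hT'T : ∀ j, T' j * T j = 1) (hT : ∀ j, ‖T j‖ ≤ 1) (hT' : ∀ j, ‖T' j‖ ≤ 1)
    (hcomm : ∀ i j, T i * T j = T j * T i) (hhT : ∀ j, h * T j = T j * h)
    (l : ℂ) (hl : l ∈ spectrum ℂ h) :
    ∃ z : ι → ℂ, (∀ j, ‖z j‖ = 1) ∧ ∀ (s : Finset ι) (a b : ι → ℂ),
      l + ∑ j ∈ s, (a j * z j + b j * (z j)⁻¹) ∈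
        spectrum ℂ (h + ∑ j ∈ s, (a j • T j + b j • T' j)) := by
  classical
  set S : Set 𝔸 := insert h (Set.range T) with hS
  set B : Subalgebra ℂ 𝔸 := Subalgebra.centralizer ℂ (Set.centralizer S) with hB
  have hSS : S ⊆ Set.centralizer S := by
    intro x hx
    rw [Set.mem_centralizer_iff]
    intro y hy
    rcases hx with rfl | ⟨i, rfl⟩ <;> rcases hy with rfl | ⟨j, rfl⟩
    · rfl
    · exact (hhT j).symm
    · exact hhT i
    · exact hcomm j i
  have hmem : ∀ x, x ∈ B ↔ ∀ y ∈ Set.centralizer S, y * x = x * y := by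
    intro x
    rw [hB, Subalgebra.mem_centralizer_iff]
  have hSB : ∀ x ∈ S, x ∈ B := by
    intro x hx
    rw [hmem]
    intro y hy
    exact ((Set.mem_centralizer_iff.1 hy) x hx).symm
  have hBc : ∀ x ∈ B, ∀ y ∈ B, x * y = y * x := by
    intro x hx y hy
    refine (hmem y).1 hy x ?_
    rw [Set.mem_centralizer_iff]
    intro w hw
    exact (hmem x).1 hx w (hSS hw)
  have hinv : ∀ x ∈ B, ∀ y, x * y = 1 → y * x = 1 → y ∈ B := by
    intro x hx y hxy hyx
    rw [hmem]
    intro w hw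
    have := (hmem x).1 hx w hw
    calc w * y = (y * x) * (w * y) := by rw [hyx, one_mul]
      _ = y * (x * w) * y := by simp only [mul_assoc]
      _ = y * (w * x) * y := by rw [this]
      _ = y * w * (x * y) := by simp only [mul_assoc]
      _ = y * w := by rw [hxy, mul_one]
  have hBcl : IsClosed (B : Set 𝔸) := by
    have := Set.isClosed_centralizer (Set.centralizer S)
    exact this
  have hspec : ∀ x : B, spectrum ℂ (x : 𝔸) = spectrum ℂ x := by
    intro x
    ext c
    rw [spectrum.mem_iff, spectrum.mem_iff, not_iff_not]
    have hco : ((algebraMap ℂ B c - x : B) : 𝔸) = algebraMap ℂ 𝔸 c - x := by simp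
    rw [← hco]
    constructor
    · rintro ⟨u, hu⟩
      have hui : (↑u⁻¹ : 𝔸) ∈ B := hinv u (hu ▸ Subtype.prop _) _ (by simp) (by simp)
      refine ⟨⟨algebraMap ℂ B c - x, ⟨_, hui⟩, ?_, ?_⟩, rfl⟩
      · apply Subtype.ext; rw [MulMemClass.coe_mul, ← hu]; simp
      · apply Subtype.ext; rw [MulMemClass.coe_mul, ← hu]; simp
    · intro hu
      exact hu.map B.val
  let _ : NormedCommRing B :=
    { (inferInstance : NormedRing B) with
      mul_comm := fun x y => Subtype.ext (hBc x x.2 y y.2) }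
  have : CompleteSpace B := hBcl.completeSpace_coe
  set h' : B := ⟨h, hSB h (by simp [hS])⟩ with hh'
  set t : ι → B := fun j => ⟨T j, hSB _ (by simp [hS])⟩ with ht
  set t' : ι → B := fun j => ⟨T' j, hinv _ (t j).2 _ (hTT' j) (hT'T j)⟩ with ht'
  have hl' : l ∈ spectrum ℂ h' := by rw [← hspec]; exact hl
  obtain ⟨χ, hχ⟩ := (WeakDual.CharacterSpace.mem_spectrum_iff_exists).1 hl'
  have hone : ∀ j, χ (t j) * χ (t' j) = 1 := by
    intro j
    rw [← map_mul, ← map_one χ]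
    congr 1
    exact Subtype.ext (hTT' j)
  have hn : ∀ x : B, ‖(x : 𝔸)‖ ≤ 1 → ‖χ x‖ ≤ 1 := by
    intro x hx
    refine (AlgHom.norm_apply_le_self_mul_norm_one χ x).trans ?_
    have h1 : ‖(1 : B)‖ = 1 := norm_one (α := 𝔸)
    rw [h1, mul_one]
    exact hx
  refine ⟨fun j => χ (t j), ?_, ?_⟩
  · intro j
    have h1 := hn (t j) (hT j)
    have h2 := hn (t' j) (hT' j)
    have h3 : ‖χ (t j)‖ * ‖χ (t' j)‖ = 1 := by rw [← norm_mul, hone, norm_one]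
    nlinarith [norm_nonneg (χ (t j)), norm_nonneg (χ (t' j))]
  · intro s a b
    have key := WeakDual.CharacterSpace.apply_mem_spectrum χ (h' + ∑ j ∈ s, (a j • t j + b j • t' j))
    rw [← hspec] at key
    have e1 : χ (h' + ∑ j ∈ s, (a j • t j + b j • t' j)) =
        l + ∑ j ∈ s, (a j * χ (t j) + b j * (χ (t j))⁻¹) := by
      rw [map_add, hχ, map_sum]
      congr 1
      refine Finset.sum_congr rfl fun j _ => ?_
      rw [map_add, map_smul, map_smul, smul_eq_mul, smul_eq_mul, eq_inv_of_mul_eq_one_right (hone j)]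
    have e2 : ((h' + ∑ j ∈ s, (a j • t j + b j • t' j) : B) : 𝔸) =
        h + ∑ j ∈ s, (a j • T j + b j • T' j) := by
      push_cast
      simp [hh', ht, ht']
    rw [e1, e2] at key
    exact key

theorem aux_near {𝔸 : Type*} [NormedAddCommGroup 𝔸] [InnerProductSpace ℂ 𝔸] [CompleteSpace 𝔸]
    (A : 𝔸 →L[ℂ] 𝔸) (hA : IsSelfAdjoint A) (c R : ℝ) (x : 𝔸) (hx : ‖x‖ = 1)
    (hR : ‖A x - (c : ℂ) • x‖ ≤ R) :
    ∃ l : ℝ, (l : ℂ) ∈ spectrum ℂ A ∧ |l - c| ≤ R := by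
  have : Nontrivial 𝔸 := ⟨x, 0, by rintro rfl; simp at hx⟩
  by_contra! hcon
  have hR0 : 0 ≤ R := (norm_nonneg _).trans hR
  have hc : IsUnit (algebraMap ℂ (𝔸 →L[ℂ] 𝔸) c - A) := by
    by_contra hu
    have := hcon c hu
    simp at this
    linarith
  obtain ⟨u, hu⟩ := hc
  have hsa : IsSelfAdjoint (u : 𝔸 →L[ℂ] 𝔸) := by
    rw [hu]
    refine IsSelfAdjoint.sub ?_ hA
    rw [IsSelfAdjoint, ← algebraMap_star_comm]
    simp
  have hsi : IsSelfAdjoint (↑u⁻¹ : 𝔸 →L[ℂ] 𝔸) := by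
    have : IsSelfAdjoint u := Units.ext hsa
    have h2 : IsSelfAdjoint u⁻¹ := this.inv
    rw [IsSelfAdjoint, ← Units.coe_star, h2]
  obtain ⟨k, hk, hkn⟩ := spectrum.exists_nnnorm_eq_spectralRadius (↑u⁻¹ : 𝔸 →L[ℂ] 𝔸)
  rw [hsi.spectralRadius_eq_nnnorm] at hkn
  have hkn' : ‖k‖ = ‖(↑u⁻¹ : 𝔸 →L[ℂ] 𝔸)‖ := by
    have := ENNReal.coe_injective hkn
    exact congrArg NNReal.toReal this
  have hk0 : k ≠ 0 := by
    rintro rfl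
    exact (spectrum.zero_mem_iff ℂ).1 hk (Units.isUnit _)
  have hki : k⁻¹ ∈ spectrum ℂ (u : 𝔸 →L[ℂ] 𝔸) := by
    have := (spectrum.inv₀_mem_iff (a := u⁻¹) (r := k⁻¹)).1 (by rwa [inv_inv])
    exact this
  have hre := hsa.mem_spectrum_eq_re hki
  set ρ : ℝ := (k⁻¹).re with hρ
  have hmem : ((c - ρ : ℝ) : ℂ) ∈ spectrum ℂ A := by
    rw [hre, spectrum.mem_iff, hu] at hki
    rw [spectrum.mem_iff]
    intro hh
    apply hki
    have := hh.neg
    convert this using 1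
    rw [Complex.ofReal_sub, map_sub]
    abel
  have h1 := hcon _ hmem
  have h2 : |ρ| = ‖k‖⁻¹ := by
    rw [← norm_inv, hre]; simp
  have h3 : R < ‖k‖⁻¹ := by
    rw [← h2]
    simpa using h1
  have h4 : ‖x‖ ≤ ‖(↑u⁻¹ : 𝔸 →L[ℂ] 𝔸)‖ * ‖(u : 𝔸 →L[ℂ] 𝔸) x‖ := by
    have : (↑u⁻¹ : 𝔸 →L[ℂ] 𝔸) ((u : 𝔸 →L[ℂ] 𝔸) x) = x := by
      rw [← mul_apply_eq_comp, Units.inv_mul]; rfl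
    calc ‖x‖ = ‖(↑u⁻¹ : 𝔸 →L[ℂ] 𝔸) ((u : 𝔸 →L[ℂ] 𝔸) x)‖ := by rw [this]
      _ ≤ _ := ContinuousLinearMap.le_opNorm _ _
  have h5 : ‖(u : 𝔸 →L[ℂ] 𝔸) x‖ ≤ R := by
    rw [hu, ← norm_neg]
    refine le_trans (le_of_eq ?_) hR
    congr 1
    simp [Algebra.algebraMap_eq_smul_one]
  rw [hx, ← hkn'] at h4
  have hkp : 0 < ‖k‖ := norm_pos_iff.2 hk0
  have h6 : ‖k‖ * R < 1 := by
    calc ‖k‖ * R < ‖k‖ * ‖k‖⁻¹ := by gcongr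
      _ = 1 := mul_inv_cancel₀ hkp.ne'
  nlinarith


section
variable {I : Type*}

/-- weighted composition operator -/
noncomputable def wcomp (σ : I ≃ I) (g : I → ℂ) (hg : ∀ i, ‖g i‖ = 1) :
    lp (fun _ : I => ℂ) 2 →L[ℂ] lp (fun _ : I => ℂ) 2 :=
  LinearMap.mkContinuous
    { toFun := fun ψ => ⟨fun i => g i * ψ (σ i), by
        have h := (memℓp_gen_iff (p := 2) (by norm_num)).1 (lp.memℓp ψ)
        refine (memℓp_gen_iff (p := 2) (by norm_num)).2 ?_
        simpa [hg, Function.comp_def] using (σ.summable_iff).2 h⟩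
      map_add' := fun x y => by ext i; exact mul_add _ _ _
      map_smul' := fun c x => by ext i; simp; ring }
    1 (fun ψ => by
      rw [one_mul]
      refine le_of_eq ?_
      rw [lp.norm_eq_tsum_rpow (by norm_num), lp.norm_eq_tsum_rpow (by norm_num)]
      congr 1
      rw [← σ.tsum_eq (fun i => ‖ψ i‖ ^ (2 : ENNReal).toReal)]
      simp [hg])

@[simp] theorem wcomp_apply (σ : I ≃ I) (g : I → ℂ) (hg : ∀ i, ‖g i‖ = 1)
    (ψ : lp (fun _ : I => ℂ) 2) (i : I) : wcomp σ g hg ψ i = g i * ψ (σ i) := rfl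

theorem wcomp_norm_le (σ : I ≃ I) (g : I → ℂ) (hg : ∀ i, ‖g i‖ = 1) : ‖wcomp σ g hg‖ ≤ 1 :=
  LinearMap.mkContinuous_norm_le _ zero_le_one _

theorem wcomp_inner (σ : I ≃ I) (x y : lp (fun _ : I => ℂ) 2) :
    inner ℂ (wcomp σ 1 (by simp) x) y = inner ℂ x (wcomp σ.symm 1 (by simp) y) := by
  rw [lp.inner_eq_tsum, lp.inner_eq_tsum,
    ← σ.tsum_eq (fun i => inner ℂ (x i) (wcomp σ.symm 1 (by simp) y i))]
  simp
end

theorem aux_measure (S : ℝ → Set ℝ) (V : Finset ℝ) (K M : ℝ) (hM : 0 ≤ M)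
    (h : ∀ μ, ∀ v ∈ V, ∃ l : ℝ, |l - μ * v| ≤ K ∧ ∀ t : ℝ, |t| ≤ M → l + t ∈ S μ) :
    ∃ μ₀ > (0 : ℝ), ∀ μ ≥ μ₀, ENNReal.ofReal (2 * M * V.card) ≤ volume (S μ) := by
  have hev : ∀ᶠ μ : ℝ in Filter.atTop, ∀ v ∈ V, ∀ w ∈ V, v ≠ w → 2 * K + 2 * M < μ * |v - w| := by
    rw [Filter.eventually_all_finset]
    intro v _
    rw [Filter.eventually_all_finset]
    intro w _
    by_cases hvw : v = w
    · simp [hvw]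
    · have : 0 < |v - w| := abs_pos.2 (sub_ne_zero.2 hvw)
      filter_upwards [(Filter.tendsto_id.atTop_mul_const this).eventually_gt_atTop (2 * K + 2 * M)] with μ hμ _
      exact hμ
  obtain ⟨μ₁, hμ₁⟩ := Filter.eventually_atTop.1 hev
  refine ⟨max μ₁ 1, by positivity, fun μ hμ => ?_⟩
  have hsep := hμ₁ μ ((le_max_left _ _).trans hμ)
  have hμ0 : 0 < μ := lt_of_lt_of_le one_pos ((le_max_right _ _).trans hμ)
  choose! l hl hS using h μ
  have hd : Set.PairwiseDisjoint (V : Set ℝ) (fun v => Set.Icc (l v - M) (l v + M)) := by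
    intro v hv w hw hvw
    rw [Function.onFun, Set.disjoint_left]
    intro x hx hx'
    have h1 := hsep v hv w hw hvw
    have h2 := abs_le.1 (hl v hv)
    have h3 := abs_le.1 (hl w hw)
    have h4 : |μ * (v - w)| ≤ 2 * K + 2 * M := by
      rw [abs_le]
      constructor <;> nlinarith [hx.1, hx.2, hx'.1, hx'.2]
    rw [abs_mul, abs_of_pos hμ0] at h4
    linarith
  calc ENNReal.ofReal (2 * M * V.card) = ∑ v ∈ V, volume (Set.Icc (l v - M) (l v + M)) := by
        simp only [Real.volume_Icc]
        have : ∀ v, l v + M - (l v - M) = 2 * M := fun v => by ring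
        simp only [this, Finset.sum_const, nsmul_eq_mul]
        rw [ENNReal.ofReal_mul (by positivity), mul_comm, ENNReal.ofReal_natCast]
    _ = volume (⋃ v ∈ V, Set.Icc (l v - M) (l v + M)) :=
        (measure_biUnion_finset hd (fun v _ => measurableSet_Icc)).symm
    _ ≤ volume (S μ) := by
        refine measure_mono ?_
        intro x hx
        simp only [Set.mem_iUnion] at hx
        obtain ⟨v, hv, hx⟩ := hx
        have := hS v hv (x - l v) (abs_le.2 ⟨by linarith [hx.1], by linarith [hx.2]⟩)
        simpa using this

section
variable {d : ℕ}

/-- shift `ψ ↦ ψ(· + e_j)` -/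
noncomputable def shiftP (j : Fin d) :
    lp (fun _ : (Fin d → ℤ) => ℂ) 2 →L[ℂ] lp (fun _ : (Fin d → ℤ) => ℂ) 2 :=
  wcomp (Equiv.addRight (Pi.single j 1)) 1 (by simp)

/-- shift `ψ ↦ ψ(· - e_j)` -/
noncomputable def shiftM (j : Fin d) :
    lp (fun _ : (Fin d → ℤ) => ℂ) 2 →L[ℂ] lp (fun _ : (Fin d → ℤ) => ℂ) 2 :=
  wcomp (Equiv.addRight (Pi.single j 1)).symm 1 (by simp)

theorem shiftP_apply (j : Fin d) (ψ : lp (fun _ : (Fin d → ℤ) => ℂ) 2) (u : Fin d → ℤ) :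
    shiftP j ψ u = ψ (u + Pi.single j 1) := by
  simp [shiftP]

theorem shiftM_apply (j : Fin d) (ψ : lp (fun _ : (Fin d → ℤ) => ℂ) 2) (u : Fin d → ℤ) :
    shiftM j ψ u = ψ (u - Pi.single j 1) := by
  simp [shiftM, sub_eq_add_neg]

theorem shiftP_inner (j : Fin d) (x y : lp (fun _ : (Fin d → ℤ) => ℂ) 2) :
    inner ℂ (shiftP j x) y = inner ℂ x (shiftM j y) := wcomp_inner _ x y

theorem shiftM_inner (j : Fin d) (x y : lp (fun _ : (Fin d → ℤ) => ℂ) 2) :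
    inner ℂ (shiftM j x) y = inner ℂ x (shiftP j y) :=
  wcomp_inner (Equiv.addRight (Pi.single j 1)).symm x y

theorem schrod_selfAdjoint (V : (Fin d → ℤ) → ℝ)
    (A : lp (fun _ : (Fin d → ℤ) => ℂ) 2 →L[ℂ] lp (fun _ : (Fin d → ℤ) => ℂ) 2)
    (hA : ∀ (ψ : lp (fun _ : (Fin d → ℤ) => ℂ) 2) (u : Fin d → ℤ),
      A ψ u = ((V u : ℝ) : ℂ) * ψ u +
        ∑ j : Fin d, (ψ (u - Pi.single j 1) + ψ (u + Pi.single j 1))) :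
    IsSelfAdjoint A := by
  rw [ContinuousLinearMap.isSelfAdjoint_iff_isSymmetric]
  set D := ∑ j : Fin d, (shiftM j + shiftP j) with hD
  have hM : ∀ ψ u, (A - D) ψ u = (V u : ℂ) * ψ u := by
    intro ψ u
    rw [_root_.sub_apply, lp.coeFn_sub, Pi.sub_apply, hA, hD,
      _root_.sum_apply, lp.coeFn_sum, Finset.sum_apply]
    simp [shiftP_apply, shiftM_apply]
  have hAD : A = (A - D) + D := by abel
  intro x y
  have h1 : inner ℂ ((A - D) x) y = inner ℂ x ((A - D) y) := by
    rw [lp.inner_eq_tsum, lp.inner_eq_tsum]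
    congr 1
    ext u
    rw [hM, hM]
    simp
    ring
  have h2 : inner ℂ (D x) y = inner ℂ x (D y) := by
    simp only [hD, _root_.sum_apply, _root_.add_apply, sum_inner,
      inner_sum, inner_add_left, inner_add_right, shiftP_inner, shiftM_inner]
    exact Finset.sum_congr rfl fun j _ => add_comm _ _
  change inner ℂ (A x) y = inner ℂ x (A y)
  rw [hAD, _root_.add_apply, _root_.add_apply, inner_add_left,
    inner_add_right, h1, h2]

theorem schrod_near (V : (Fin d → ℤ) → ℝ)
    (A : lp (fun _ : (Fin d → ℤ) => ℂ) 2 →L[ℂ] lp (fun _ : (Fin d → ℤ) => ℂ) 2)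
    (hA : ∀ (ψ : lp (fun _ : (Fin d → ℤ) => ℂ) 2) (u : Fin d → ℤ),
      A ψ u = ((V u : ℝ) : ℂ) * ψ u +
        ∑ j : Fin d, (ψ (u - Pi.single j 1) + ψ (u + Pi.single j 1))) (u : Fin d → ℤ) :
    ∃ l : ℝ, (l : ℂ) ∈ spectrum ℂ A ∧ |l - V u| ≤ 2 * d := by
  classical
  have hx : ‖(lp.single 2 u (1 : ℂ) : lp (fun _ : (Fin d → ℤ) => ℂ) 2)‖ = 1 := by
    rw [lp.norm_single (by norm_num)]; simp
  refine aux_near A (schrod_selfAdjoint V A hA) (V u) _ (lp.single 2 u (1 : ℂ)) hx ?_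
  set x : lp (fun _ : (Fin d → ℤ) => ℂ) 2 := lp.single 2 u (1 : ℂ) with hxd
  have e : A x - (V u : ℂ) • x = ∑ j : Fin d, (shiftM j x + shiftP j x) := by
    ext w
    rw [lp.coeFn_sub, Pi.sub_apply, hA, lp.coeFn_sum, Finset.sum_apply]
    have : (V w : ℂ) * x w = (V u : ℂ) * x w := by
      by_cases hw : w = u
      · rw [hw]
      · rw [hxd, lp.single_apply_ne _ _ _ hw, mul_zero, mul_zero]
    have hs : ((V u : ℂ) • x) w = (V u : ℂ) * x w := by
      rw [lp.coeFn_smul]; rfl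
    rw [hs, this, add_sub_cancel_left]
    simp [shiftP_apply, shiftM_apply]
  rw [e]
  refine (norm_sum_le _ _).trans ?_
  have hb : ∀ j ∈ (Finset.univ : Finset (Fin d)), ‖shiftM j x + shiftP j x‖ ≤ 2 := by
    intro j _
    refine (norm_add_le _ _).trans ?_
    have h1 : ‖shiftM j x‖ ≤ 1 := by
      have := ContinuousLinearMap.le_of_opNorm_le _ (wcomp_norm_le (Equiv.addRight (Pi.single j (1:ℤ))).symm 1 (by simp)) x
      rwa [hx, one_mul] at this
    have h2 : ‖shiftP j x‖ ≤ 1 := by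
      have := ContinuousLinearMap.le_of_opNorm_le _ (wcomp_norm_le (Equiv.addRight (Pi.single j (1:ℤ))) 1 (by simp)) x
      rwa [hx, one_mul] at this
    linarith
  refine (Finset.sum_le_sum hb).trans ?_
  simp [mul_comm]

theorem schrod_spec (V : (Fin d → ℤ) → ℝ)
    (A : lp (fun _ : (Fin d → ℤ) => ℂ) 2 →L[ℂ] lp (fun _ : (Fin d → ℤ) => ℂ) 2)
    (hA : ∀ (ψ : lp (fun _ : (Fin d → ℤ) => ℂ) 2) (u : Fin d → ℤ),
      A ψ u = ((V u : ℝ) : ℂ) * ψ u +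
        ∑ j : Fin d, (ψ (u - Pi.single j 1) + ψ (u + Pi.single j 1)))
    (W : Fin d → ℂ) (hW : ∀ j, ‖W j‖ = 1) :
    spectrum ℂ (A + ∑ j : Fin d, ((W j - 1) • shiftP j + ((W j)⁻¹ - 1) • shiftM j)) =
      spectrum ℂ A := by
  have hW0 : ∀ j, W j ≠ 0 := fun j h => by simpa [h] using hW j
  set g : (Fin d → ℤ) → ℂ := fun u => ∏ j, W j ^ (u j) with hg
  have hgn : ∀ u, ‖g u‖ = 1 := by
    intro u
    simp [hg, norm_prod, norm_zpow, hW]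
  have hg0 : ∀ u, g u ≠ 0 := fun u h => by simpa [h] using hgn u
  have hgp : ∀ u j, g (u + Pi.single j 1) = g u * W j := by
    intro u j
    simp only [hg, Pi.add_apply, zpow_add₀ (hW0 _), Finset.prod_mul_distrib]
    congr 1
    rw [Finset.prod_eq_single j]
    · simp
    · intro i _ hi
      simp [hi]
    · simp
  have hgm : ∀ u j, g (u - Pi.single j 1) = g u * (W j)⁻¹ := by
    intro u j
    have := hgp (u - Pi.single j 1) j
    rw [sub_add_cancel] at this
    rw [this, mul_assoc, mul_inv_cancel₀ (hW0 j), mul_one]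
  let U : (lp (fun _ : (Fin d → ℤ) => ℂ) 2 →L[ℂ] lp (fun _ : (Fin d → ℤ) => ℂ) 2)ˣ :=
    ⟨wcomp (Equiv.refl _) g hgn, wcomp (Equiv.refl _) (fun u => (g u)⁻¹) (by simp [hgn]),
      by ext ψ u; simp [hg0], by ext ψ u; simp [hg0]⟩
  rw [← spectrum.units_conjugate' (u := U) (a := A)]
  congr 1
  ext ψ u
  have h1 : ∀ φ : lp (fun _ : (Fin d → ℤ) => ℂ) 2, ∀ u,
    (U : lp (fun _ : (Fin d → ℤ) => ℂ) 2 →L[ℂ] lp (fun _ : (Fin d → ℤ) => ℂ) 2) φ u = g u * φ u :=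
    fun _ _ => rfl
  have h2 : ∀ φ : lp (fun _ : (Fin d → ℤ) => ℂ) 2, ∀ u,
    (↑U⁻¹ : lp (fun _ : (Fin d → ℤ) => ℂ) 2 →L[ℂ] lp (fun _ : (Fin d → ℤ) => ℂ) 2) φ u
      = (g u)⁻¹ * φ u :=
    fun _ _ => rfl
  rw [mul_apply_eq_comp, mul_apply_eq_comp, h2, hA, _root_.add_apply, lp.coeFn_add,
    Pi.add_apply, hA, _root_.sum_apply, lp.coeFn_sum, Finset.sum_apply, add_assoc,
    ← Finset.sum_add_distrib, mul_add, Finset.mul_sum]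
  congr 1
  · rw [h1]
    have := hg0 u
    field_simp
  · refine Finset.sum_congr rfl fun j _ => ?_
    rw [h1, h1, hgp, hgm]
    have hw := hW0 j
    simp only [_root_.add_apply, _root_.smul_apply, lp.coeFn_add,
      lp.coeFn_smul, Pi.add_apply, Pi.smul_apply, shiftP_apply, shiftM_apply, smul_eq_mul]
    have := hg0 u
    field_simp
    ring

theorem schrod_intervals (V : (Fin d → ℤ) → ℝ)
    (A : lp (fun _ : (Fin d → ℤ) => ℂ) 2 →L[ℂ] lp (fun _ : (Fin d → ℤ) => ℂ) 2)
    (hA : ∀ (ψ : lp (fun _ : (Fin d → ℤ) => ℂ) 2) (u : Fin d → ℤ),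
      A ψ u = ((V u : ℝ) : ℂ) * ψ u +
        ∑ j : Fin d, (ψ (u - Pi.single j 1) + ψ (u + Pi.single j 1)))
    (L : Finset (Fin d)) (hL : 0 < L.card)
    (hV : ∀ j ∈ L, ∀ u, V (u + Pi.single j 1) = V u) (u : Fin d → ℤ) :
    ∃ l : ℝ, |l - V u| ≤ 2 * d + 2 * L.card ∧
      ∀ t : ℝ, |t| ≤ 2 * L.card → ((l + t : ℝ) : ℂ) ∈ spectrum ℂ A := by
  classical
  have : Nontrivial (lp (fun _ : (Fin d → ℤ) => ℂ) 2) := by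
    refine ⟨lp.single 2 u (1 : ℂ), 0, fun h => ?_⟩
    have h1 : ‖(lp.single 2 u (1 : ℂ) : lp (fun _ : (Fin d → ℤ) => ℂ) 2)‖ = 1 := by
      rw [lp.norm_single (by norm_num)]; simp
    rw [h, norm_zero] at h1
    exact zero_ne_one h1
  obtain ⟨l₀, hl₀, hl₀'⟩ := schrod_near V A hA u
  obtain ⟨z, hz, hspec⟩ := aux_character A (fun j : L => shiftP (j : Fin d)) (fun j => shiftM (j : Fin d))
    (by intro j; ext ψ w; simp [shiftP_apply, shiftM_apply])
    (by intro j; ext ψ w; simp [shiftP_apply, shiftM_apply])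
    (fun j => wcomp_norm_le _ _ _) (fun j => wcomp_norm_le _ _ _)
    (by intro i j; ext ψ w; simp [shiftP_apply, add_right_comm])
    (by
      intro j; ext ψ w
      rw [mul_apply_eq_comp, mul_apply_eq_comp, shiftP_apply, hA, hA, hV j j.2]
      simp only [shiftP_apply]
      congr 1
      refine Finset.sum_congr rfl fun i _ => ?_
      rw [add_right_comm, sub_add_eq_add_sub]) l₀ hl₀
  have hzi : ∀ j, (z j)⁻¹ = (starRingEnd ℂ) (z j) := fun j => by
    rw [Complex.inv_def, Complex.normSq_eq_norm_sq, hz]; simp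
  have hz0 : ∀ j, z j ≠ 0 := fun j h => by simpa [h] using hz j
  have hzs : ∀ j, z j + (z j)⁻¹ = ((2 * (z j).re : ℝ) : ℂ) := fun j => by
    rw [hzi, Complex.add_conj]
  refine ⟨l₀ - ∑ j, 2 * (z j).re, ?_, ?_⟩
  · have : |∑ j, 2 * (z j).re| ≤ 2 * L.card := by
      refine (Finset.abs_sum_le_sum_abs _ _).trans ?_
      refine (Finset.sum_le_sum (g := fun _ => (2 : ℝ)) fun j _ => ?_).trans ?_
      · rw [abs_mul, abs_two]
        have := Complex.abs_re_le_norm (z j)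
        rw [hz] at this
        linarith
      · simp [mul_comm]
    calc |l₀ - ∑ j, 2 * (z j).re - V u| = |(l₀ - V u) - ∑ j, 2 * (z j).re| := by congr 1; ring
      _ ≤ |l₀ - V u| + |∑ j, 2 * (z j).re| := abs_sub _ _
      _ ≤ _ := by linarith
  · intro t ht
    have hLp : (0 : ℝ) < 2 * L.card := by positivity
    set α : ℝ := Real.arccos (t / (2 * L.card)) with hα
    have hcos : Real.cos α = t / (2 * L.card) := by
      rw [abs_le] at ht
      apply Real.cos_arccos
      · rw [le_div_iff₀ hLp]; linarith
      · rw [div_le_iff₀ hLp]; linarith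
    set E : ℂ := Complex.exp (α * Complex.I) with hE
    have hEn : ‖E‖ = 1 := Complex.norm_exp_ofReal_mul_I α
    have hEs : E + E⁻¹ = ((2 * Real.cos α : ℝ) : ℂ) := by
      rw [hE, ← Complex.exp_neg]
      push_cast
      rw [Complex.two_cos]
      congr 2
      ring
    set W : Fin d → ℂ := fun j => if h : j ∈ L then (z ⟨j, h⟩)⁻¹ * E else 1 with hWd
    have hW : ∀ j, ‖W j‖ = 1 := by
      intro j
      by_cases h : j ∈ L
      · simp [hWd, h, hz, hEn]
      · simp [hWd, h]
    have hWL : ∀ j : L, W j = (z j)⁻¹ * E := by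
      intro j; simp [hWd]
    rw [← schrod_spec V A hA W hW]
    have key := hspec Finset.univ (fun j => W j - 1) (fun j => (W j)⁻¹ - 1)
    have hsum : ∑ j : Fin d, ((W j - 1) • shiftP j + ((W j)⁻¹ - 1) • shiftM j) =
        ∑ j : L, ((W j - 1) • shiftP (j : Fin d) + ((W j)⁻¹ - 1) • shiftM (j : Fin d)) := by
      rw [Finset.sum_coe_sort L
        (fun j => ((W j - 1) • shiftP j + ((W j)⁻¹ - 1) • shiftM j))]
      refine (Finset.sum_subset (Finset.subset_univ L) fun j _ hj => ?_).symm
      simp [hWd, hj]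
    rw [hsum]
    convert key using 1
    have : ∀ j : L, (W j - 1) * z j + ((W j)⁻¹ - 1) * (z j)⁻¹ =
        ((t / L.card : ℝ) : ℂ) - ((2 * (z j).re : ℝ) : ℂ) := by
      intro j
      have e1 : (W j - 1) * z j + ((W j)⁻¹ - 1) * (z j)⁻¹ = (E + E⁻¹) - (z j + (z j)⁻¹) := by
        rw [hWL, mul_inv, inv_inv]
        have := hz0 j
        have hE0 : E ≠ 0 := Complex.exp_ne_zero _
        field_simp
        ring
      rw [e1, hEs, hzs, hcos]
      congr 2
      field_simp
    rw [Finset.sum_congr rfl fun j _ => this j, Finset.sum_sub_distrib]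
    simp only [Finset.sum_const, Finset.card_univ, Fintype.card_coe, nsmul_eq_mul]
    push_cast
    have : (L.card : ℂ) ≠ 0 := by exact_mod_cast hL.ne'
    field_simp
    ring
end

/-- If `Q : ℤ^d → ℝ` is `(q₁,…,q_d)`-periodic with `q_{d−m+1} = ⋯ = q_d = 1` and takes
exactly `r` distinct values, then for all sufficiently large `μ > 0` the Lebesgue
measure of the spectrum of `H_{μQ} = Δ_{(1,d)} + μQ` on `ℓ²(ℤ^d)` is at least `4mr`. -/
theorem measure_spectrum_ge_of_separable
    {d m : ℕ} (hd : 1 ≤ d) (hm : 1 ≤ m) (hmd : m ≤ d)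
    (q : Fin d → ℕ) (hqpos : ∀ j, 0 < q j)
    (Q : (Fin d → ℤ) → ℝ)
    -- `Q` is `(q₁,…,q_d)`-periodic
    (hQper : ∀ (j : Fin d) (u : Fin d → ℤ), Q (u + (q j : ℤ) • Pi.single j 1) = Q u)
    -- the last `m` periods equal `1`
    (hqlast : ∀ j : Fin d, d - m ≤ (j : ℕ) → q j = 1)
    -- `r` is the number of distinct values of `Q`
    (r : ℕ) (hr : (Set.range Q).ncard = r)
    -- `H μ` is the operator `Δ_{(1,d)} + μQ` on `ℓ²(ℤ^d)`
    (H : ℝ → (lp (fun _ : (Fin d → ℤ) => ℂ) 2 →L[ℂ] lp (fun _ : (Fin d → ℤ) => ℂ) 2))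
    (hH : ∀ (μ : ℝ) (ψ : lp (fun _ : (Fin d → ℤ) => ℂ) 2) (u : Fin d → ℤ),
      H μ ψ u = ((μ * Q u : ℝ) : ℂ) * ψ u +
        ∑ j : Fin d, (ψ (u - Pi.single j 1) + ψ (u + Pi.single j 1))) :
    ∃ μ₀ > (0 : ℝ), ∀ μ ≥ μ₀,
      ENNReal.ofReal (4 * (m : ℝ) * (r : ℝ)) ≤
        volume {x : ℝ | (x : ℂ) ∈ spectrum ℂ (H μ)} := by
  have hcard : (Finset.univ.filter fun j : Fin d => d - m ≤ (j : ℕ)).card = m := by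
    have h1 := Fin.card_filter_val_lt (n := d) (m := d - m)
    have h2 := Finset.card_filter_add_card_filter_not (s := (Finset.univ : Finset (Fin d)))
      (fun j : Fin d => (j : ℕ) < d - m)
    simp only [not_lt, Finset.card_univ, Fintype.card_fin] at h2
    omega
  by_cases hfin : (Set.range Q).Finite
  · have hrc : hfin.toFinset.card = r := by
      rw [← hr, Set.ncard_eq_toFinset_card _ hfin]
    obtain ⟨μ₀, hμ₀, h⟩ := aux_measure (fun μ => {x : ℝ | (x : ℂ) ∈ spectrum ℂ (H μ)})
      hfin.toFinset (2 * d + 2 * m) (2 * m) (by positivity) (by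
        intro μ v hv
        rw [Set.Finite.mem_toFinset] at hv
        obtain ⟨u, rfl⟩ := hv
        have := schrod_intervals (fun u => μ * Q u) (H μ) (hH μ)
          (Finset.univ.filter fun j : Fin d => d - m ≤ (j : ℕ)) (by omega)
          (by
            intro j hj w
            have hj' := (Finset.mem_filter.1 hj).2
            have := hQper j w
            rw [hqlast j hj'] at this
            simp only [Nat.cast_one, one_smul] at this
            simp only [this]) u
        rw [hcard] at this
        exact this)
    refine ⟨μ₀, hμ₀, fun μ hμ => ?_⟩
    have := h μ hμ
    rw [hrc] at this
    convert this using 2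
    ring
  · have : r = 0 := by rw [← hr]; exact Set.Infinite.ncard hfin
    subst this
    exact ⟨1, one_pos, fun μ _ => by simp⟩
end
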